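/- Let F ∈ 𝓔^m be essentially smooth. Then the map Σ ↦ (Σ_A, (∇F(Σ))_B) is a bijection from S^m_+ onto (S^m_+)_A × (𝕃^m_+)_B. -/

import Mathlib

open Matrix Filter Topology

namespace Entropic

abbrev Mat (m : ℕ) := Matrix (Fin m) (Fin m) ℝ

variable {m : ℕ}

/-- The trace inner product `⟨A,B⟩ = tr(AB)` on matrices. -/
noncomputable def ip (A B : Mat m) : ℝ := (A * B).trace

/-- The Frobenius norm `‖A‖_F = √tr(AAᵀ)`. -/
noncomputable def fnorm (A : Mat m) : ℝ := Real.sqrt (ip A Aᵀ)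

/-- The class `𝓔^m`: proper convex lower semicontinuous `F : S^m → ℝ ∪ {+∞}` with
`S^m_+ ⊆ dom F ⊆ cl(S^m_+)` which is strictly convex and continuously differentiable on
`S^m_+`; the (trace-inner-product) gradient on `S^m_+` is bundled as `grad`. -/
structure EClass (m : ℕ) where
  F : Mat m → EReal
  grad : Mat m → Mat m
  F_ne_bot : ∀ A : Mat m, F A ≠ ⊥
  convex : ∀ x y : Mat m, x.IsHermitian → y.IsHermitian → ∀ a b : ℝ,
    0 ≤ a → 0 ≤ b → a + b = 1 →
    F (a • x + b • y) ≤ (a : EReal) * F x + (b : EReal) * F y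
  lsc : LowerSemicontinuousOn F {A : Mat m | A.IsHermitian}
  posDef_mem_dom : ∀ A : Mat m, A.PosDef → F A ≠ ⊤
  dom_subset_psd : ∀ A : Mat m, F A ≠ ⊤ → A.PosSemidef
  strictConvex : ∀ x y : Mat m, x.PosDef → y.PosDef → x ≠ y → ∀ a b : ℝ,
    0 < a → 0 < b → a + b = 1 →
    F (a • x + b • y) < (a : EReal) * F x + (b : EReal) * F y
  grad_isHermitian : ∀ P : Mat m, P.PosDef → (grad P).IsHermitian
  hasGradAt : ∀ P : Mat m, P.PosDef → ∀ H : Mat m, H.IsHermitian →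
    HasDerivAt (fun t : ℝ => (F (P + t • H)).toReal) (ip (grad P) H) 0
  grad_continuousOn : ContinuousOn grad {A : Mat m | A.PosDef}

/-- `𝕃^m_+ = ∇F(S^m_+)`. -/
def Lplus (E : EClass m) : Set (Mat m) := E.grad '' {A : Mat m | A.PosDef}

/-- The Fenchel conjugate `F*(L) = sup_{Σ ∈ S^m} (⟨Σ,L⟩ − F(Σ))`. -/
noncomputable def conj (E : EClass m) (L : Mat m) : EReal :=
  ⨆ S : {A : Mat m // A.IsHermitian}, ((ip (S : Mat m) L : EReal) - E.F (S : Mat m))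

/-- `g_n(L) = −F*(L) + ⟨L, S_n⟩`. -/
noncomputable def gn (E : EClass m) (Sn L : Mat m) : EReal :=
  -(conj E L) + (ip L Sn : EReal)

/-- A set `U ⊆ S^m` is (relatively) open in `S^m`. -/
def RelOpen (U : Set (Mat m)) : Prop :=
  U ⊆ {A : Mat m | A.IsHermitian} ∧
    ∀ L ∈ U, ∃ ε > 0, ∀ M : Mat m, M.IsHermitian → fnorm (M - L) < ε → M ∈ U

/-- The affine subspace `A₀ + V` of `S^m`. -/
def affSet (A0 : Mat m) (V : Submodule ℝ (Mat m)) : Set (Mat m) :=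
  {L : Mat m | L - A0 ∈ V}

/-- The orthogonal complement in `S^m` (w.r.t. the trace inner product) of the linear
subspace `V`. -/
def perp (V : Submodule ℝ (Mat m)) : Set (Mat m) :=
  {W : Mat m | W.IsHermitian ∧ ∀ U ∈ V, ip W U = 0}


/-- `F ∈ 𝓔^m` is essentially smooth. -/
def EssSmooth {m : ℕ} (E : EClass m) : Prop :=
  ∀ (P : ℕ → Mat m) (B : Mat m), (∀ k, (P k).PosDef) → Tendsto P atTop (𝓝 B) →
    B.PosSemidef → ¬ B.PosDef → Tendsto (fun k => fnorm (E.grad (P k))) atTop atTop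

/-- The component of a symmetric matrix corresponding to a set `s` of entry positions:
entries outside `s` are replaced by `0`. -/
noncomputable def comp {m : ℕ} (s : Set (Fin m × Fin m)) (P : Mat m) : Mat m :=
  fun i j => s.indicator (fun q => P q.1 q.2) (i, j)

section TraceInnerProduct

theorem ip_add_right (A B C : Mat m) : ip A (B + C) = ip A B + ip A C := by
  simp [ip, Matrix.mul_add]

theorem ip_sub_right (A B C : Mat m) : ip A (B - C) = ip A B - ip A C := by
  simp [ip, Matrix.mul_sub]

theorem ip_sub_left (A B C : Mat m) : ip (A - B) C = ip A C - ip B C := by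
  simp [ip, Matrix.sub_mul]

theorem ip_smul_right (A B : Mat m) (c : ℝ) : ip A (c • B) = c * ip A B := by
  simp [ip]

theorem ip_neg_right (A B : Mat m) : ip A (-B) = -ip A B := by
  simp [ip]

theorem ip_eq_sum (A B : Mat m) : ip A B = ∑ i, ∑ j, A i j * B j i := by
  simp [ip, Matrix.trace, Matrix.mul_apply]

theorem continuous_ip_right (A : Mat m) : Continuous fun B : Mat m => ip A B := by
  unfold ip
  fun_prop

/-- The symmetric matrix pairing with a symmetric matrix to twice its `(i, j)` entry. -/
def symmUnit (i j : Fin m) : Mat m :=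
  Matrix.single i j 1 + Matrix.single j i 1

theorem isHermitian_symmUnit (i j : Fin m) : (symmUnit i j).IsHermitian := by
  simp [symmUnit, Matrix.IsHermitian, add_comm]

theorem ip_symmUnit {A : Mat m} (hA : A.IsHermitian) (i j : Fin m) :
    ip A (symmUnit i j) = 2 * A i j := by
  have h : A j i = A i j := by simpa using hA.apply i j
  rw [symmUnit, ip_add_right]
  simp only [ip, Matrix.trace_mul_single]
  simp [h, two_mul]

theorem fnorm_le_of_forall_abs_le {A : Mat m} {C : ℝ} (h : ∀ i j, |A i j| ≤ C) :
    fnorm A ≤ Real.sqrt (∑ _i : Fin m, ∑ _j : Fin m, C ^ 2) := by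
  refine Real.sqrt_le_sqrt ?_
  rw [ip_eq_sum]
  refine Finset.sum_le_sum fun i _ => Finset.sum_le_sum fun j _ => ?_
  rw [Matrix.transpose_apply, ← sq]
  exact sq_le_sq' (abs_le.1 (h i j)).1 (abs_le.1 (h i j)).2

end TraceInnerProduct

section PosDef

theorem posDef_combination {P Q : Mat m} (hP : P.PosDef) (hQ : Q.PosSemidef) {a b : ℝ}
    (ha : 0 < a) (hb : 0 ≤ b) : (a • P + b • Q).PosDef :=
  (hP.smul ha).add_posSemidef (hQ.smul hb)

theorem isHermitian_combination {P Q : Mat m} (hP : P.IsHermitian) (hQ : Q.IsHermitian)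
    (a b : ℝ) : (a • P + b • Q).IsHermitian := by
  simp only [Matrix.IsHermitian, Matrix.conjTranspose_add, Matrix.conjTranspose_smul, hP.eq,
    hQ.eq, star_trivial]

theorem eventually_posDef_add_smul {P H : Mat m} (hP : P.PosDef) (hH : H.IsHermitian) :
    ∀ᶠ t : ℝ in 𝓝 0, (P + t • H).PosDef := by
  have key : ∀ᶠ t : ℝ in 𝓝 0, ∀ x ∈ Metric.sphere (0 : Fin m → ℝ) 1,
      0 < x ⬝ᵥ ((P + t • H) *ᵥ x) := by
    refine (isCompact_sphere _ _).eventually_forall_of_forall_eventually fun x hx => ?_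
    have hc : Continuous fun z : ℝ × (Fin m → ℝ) => z.2 ⬝ᵥ ((P + z.1 • H) *ᵥ z.2) := by
      fun_prop
    have h0 : 0 < x ⬝ᵥ ((P + (0 : ℝ) • H) *ᵥ x) := by
      have hx0 : x ≠ 0 := by
        rintro rfl
        simp at hx
      simpa using hP.dotProduct_mulVec_pos hx0
    exact hc.continuousAt.eventually (lt_mem_nhds h0)
  filter_upwards [key] with t ht
  have hherm : (P + t • H).IsHermitian := by
    simpa using isHermitian_combination hP.isHermitian hH 1 t
  refine .of_dotProduct_mulVec_pos hherm fun x hx => ?_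
  have hn : 0 < ‖x‖ := norm_pos_iff.2 hx
  have h := ht (‖x‖⁻¹ • x) (by simp [norm_smul, hn.ne'])
  rw [Matrix.mulVec_smul, smul_dotProduct, dotProduct_smul, smul_eq_mul, smul_eq_mul] at h
  have hi : 0 < ‖x‖⁻¹ := inv_pos.2 hn
  simpa using pos_of_mul_pos_right (pos_of_mul_pos_right h hi.le) hi.le

end PosDef

namespace EClass

variable (E : EClass m)

/-- The effective domain of `F` within the symmetric matrices. -/
def dom : Set (Mat m) := {A | A.IsHermitian ∧ E.F A ≠ ⊤}

/-- The real value of `F`, meaningful on the effective domain. -/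
noncomputable def val (A : Mat m) : ℝ := (E.F A).toReal

variable {E}

theorem coe_val {A : Mat m} (hA : A ∈ E.dom) : (E.val A : EReal) = E.F A :=
  EReal.coe_toReal hA.2 (E.F_ne_bot A)

theorem _root_.Matrix.PosDef.mem_dom {P : Mat m} (hP : P.PosDef) : P ∈ E.dom :=
  ⟨hP.isHermitian, E.posDef_mem_dom P hP⟩

theorem combination_mem_dom {A B : Mat m} (hA : A ∈ E.dom) (hB : B ∈ E.dom) {a b : ℝ}
    (ha : 0 ≤ a) (hb : 0 ≤ b) (hab : a + b = 1) : a • A + b • B ∈ E.dom := by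
  refine ⟨isHermitian_combination hA.1 hB.1 a b, ne_top_of_le_ne_top ?_
    (E.convex A B hA.1 hB.1 a b ha hb hab)⟩
  rw [← coe_val hA, ← coe_val hB, ← EReal.coe_mul, ← EReal.coe_mul, ← EReal.coe_add]
  exact EReal.coe_ne_top _

theorem val_combination_le {A B : Mat m} (hA : A ∈ E.dom) (hB : B ∈ E.dom) {a b : ℝ}
    (ha : 0 ≤ a) (hb : 0 ≤ b) (hab : a + b = 1) :
    E.val (a • A + b • B) ≤ a * E.val A + b * E.val B := by
  have h := E.convex A B hA.1 hB.1 a b ha hb hab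
  rw [← coe_val hA, ← coe_val hB, ← coe_val (combination_mem_dom hA hB ha hb hab)] at h
  exact_mod_cast h

theorem val_combination_lt {P Q : Mat m} (hP : P.PosDef) (hQ : Q.PosDef) (hne : P ≠ Q)
    {a b : ℝ} (ha : 0 < a) (hb : 0 < b) (hab : a + b = 1) :
    E.val (a • P + b • Q) < a * E.val P + b * E.val Q := by
  have h := E.strictConvex P Q hP hQ hne a b ha hb hab
  rw [← coe_val hP.mem_dom, ← coe_val hQ.mem_dom,
    ← coe_val (combination_mem_dom hP.mem_dom hQ.mem_dom ha.le hb.le hab)] at h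
  exact_mod_cast h

theorem val_add_ip_le {P A : Mat m} (hP : P.PosDef) (hA : A ∈ E.dom) :
    E.val P + ip (E.grad P) (A - P) ≤ E.val A := by
  have hd := (E.hasGradAt P hP (A - P) (hA.1.sub hP.isHermitian)).tendsto_slope_zero_right
  have hle : ip (E.grad P) (A - P) ≤ E.val A - E.val P := by
    refine le_of_tendsto hd ?_
    filter_upwards [Ioo_mem_nhdsGT (zero_lt_one' ℝ)] with t ht
    have hc := val_combination_le hP.mem_dom hA (sub_nonneg.2 ht.2.le) ht.1.le
      (sub_add_cancel 1 t)
    have he : (1 - t) • P + t • A = P + t • (A - P) := by module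
    rw [he] at hc
    simp only [zero_add, zero_smul, add_zero, smul_eq_mul]
    rw [inv_mul_le_iff₀ ht.1]
    change E.val (P + t • (A - P)) - E.val P ≤ _
    linarith
  linarith

theorem val_add_ip_lt {P A : Mat m} (hP : P.PosDef) (hA : A ∈ E.dom) (hne : P ≠ A) :
    E.val P + ip (E.grad P) (A - P) < E.val A := by
  have half : (0 : ℝ) < 1 / 2 := by norm_num
  set M : Mat m := (1 / 2 : ℝ) • P + (1 / 2 : ℝ) • A with hM
  have hMpd : M.PosDef := posDef_combination hP (E.dom_subset_psd A hA.2) half half.le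
  have hMP : M - P = (1 / 2 : ℝ) • (A - P) := by rw [hM]; module
  have hPM : P ≠ M := by
    intro h
    rw [← h, sub_self, eq_comm, smul_eq_zero] at hMP
    exact hne (sub_eq_zero.1 (hMP.resolve_left half.ne')).symm
  have h1 := val_combination_lt (E := E) hP hMpd hPM half half (by norm_num)
  have h2 := val_combination_le hP.mem_dom hA half.le half.le (by norm_num)
  have h3 := val_add_ip_le hP
    (posDef_combination hP hMpd.posSemidef half half.le).mem_dom (E := E)
  have hsub : (1 / 2 : ℝ) • P + (1 / 2 : ℝ) • M - P = (1 / 4 : ℝ) • (A - P) := by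
    rw [hM]; module
  rw [hsub, ip_smul_right] at h3
  rw [← hM] at h2
  linarith

theorem ip_grad_sub_nonneg {P Q : Mat m} (hP : P.PosDef) (hQ : Q.PosDef) :
    0 ≤ ip (E.grad P - E.grad Q) (P - Q) := by
  have h1 := val_add_ip_le (E := E) hP hQ.mem_dom
  have h2 := val_add_ip_le (E := E) hQ hP.mem_dom
  rw [← neg_sub P Q, ip_neg_right] at h1
  rw [ip_sub_left]
  linarith

theorem ip_grad_sub_pos {P Q : Mat m} (hP : P.PosDef) (hQ : Q.PosDef) (hne : P ≠ Q) :
    0 < ip (E.grad P - E.grad Q) (P - Q) := by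
  have h1 := val_add_ip_lt (E := E) hP hQ.mem_dom hne
  have h2 := val_add_ip_lt (E := E) hQ hP.mem_dom hne.symm
  rw [← neg_sub P Q, ip_neg_right] at h1
  rw [ip_sub_left]
  linarith

theorem exists_forall_val_sub_ip_le_of_isCompact {K : Set (Mat m)} (hK : IsCompact K)
    (hherm : ∀ A ∈ K, A.IsHermitian) (hne : (K ∩ E.dom).Nonempty) (L : Mat m) :
    ∃ A ∈ K ∩ E.dom, ∀ B ∈ K ∩ E.dom, E.val A - ip L A ≤ E.val B - ip L B := by
  have hlsc : LowerSemicontinuousOn (fun A => E.F A + ((-ip L A : ℝ) : EReal)) K := by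
    refine (E.lsc.mono hherm).add' ?_ fun A _ =>
      EReal.continuousAt_add (Or.inr (EReal.coe_ne_bot _)) (Or.inr (EReal.coe_ne_top _))
    exact (continuous_coe_real_ereal.comp
      (continuous_ip_right L).neg).lowerSemicontinuous.lowerSemicontinuousOn K
  obtain ⟨A, hAK, hmin⟩ := hlsc.exists_isMinOn (hne.mono Set.inter_subset_left) hK
  have hval : ∀ B ∈ K ∩ E.dom,
      E.F A + ((-ip L A : ℝ) : EReal) ≤ ((E.val B - ip L B : ℝ) : EReal) := by
    intro B hB
    have h := hmin hB.1
    simp only [Set.mem_ofPred_eq] at h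
    rwa [← coe_val hB.2, ← EReal.coe_add, ← sub_eq_add_neg] at h
  have hA : A ∈ E.dom := by
    refine ⟨hherm A hAK, fun htop => ?_⟩
    obtain ⟨B, hB⟩ := hne
    have h := hval B hB
    rw [htop, EReal.top_add_coe, top_le_iff] at h
    exact EReal.coe_ne_top _ h
  refine ⟨A, ⟨hAK, hA⟩, fun B hB => ?_⟩
  have h := hval B hB
  rw [← coe_val hA, ← EReal.coe_add, ← sub_eq_add_neg] at h
  exact_mod_cast h

section Growth

attribute [local instance] Matrix.normedAddCommGroup Matrix.normedSpace

theorem isClosed_setOf_isHermitian : IsClosed {A : Mat m | A.IsHermitian} :=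
  isClosed_eq (by fun_prop) continuous_id

/-- Linear growth of `F - ⟨∇F(P), ·⟩` away from its minimizer `P`. -/
theorem exists_linear_growth {P : Mat m} (hP : P.PosDef) :
    ∃ δ > 0, ∀ A ∈ E.dom, 1 ≤ ‖A - P‖ →
      E.val P - ip (E.grad P) P + δ * ‖A - P‖ ≤ E.val A - ip (E.grad P) A := by
  have : ProperSpace (Mat m) := FiniteDimensional.proper_real _
  set K : Set (Mat m) := Metric.sphere P 1 ∩ {A | A.IsHermitian} with hKdef
  have hK : IsCompact K := (isCompact_sphere P 1).inter_right isClosed_setOf_isHermitian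
  have hretract : ∀ A ∈ E.dom, 1 ≤ ‖A - P‖ →
      (1 - ‖A - P‖⁻¹) • P + ‖A - P‖⁻¹ • A ∈ K ∩ E.dom := by
    intro A hA hr
    have hr0 : 0 < ‖A - P‖ := zero_lt_one.trans_le hr
    have hmem := combination_mem_dom (E := E) hP.mem_dom hA
      (sub_nonneg.2 (inv_le_one_of_one_le₀ hr)) (inv_nonneg.2 hr0.le) (sub_add_cancel _ _)
    refine ⟨⟨?_, hmem.1⟩, hmem⟩
    have he : (1 - ‖A - P‖⁻¹) • P + ‖A - P‖⁻¹ • A - P = ‖A - P‖⁻¹ • (A - P) := by module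
    rw [mem_sphere_iff_norm, he, norm_smul, norm_inv, norm_norm, inv_mul_cancel₀ hr0.ne']
  by_cases hne : (K ∩ E.dom).Nonempty
  · obtain ⟨B, hB, hmin⟩ :=
      exists_forall_val_sub_ip_le_of_isCompact hK (fun A hA => hA.2) hne (E.grad P)
    have hPB : P ≠ B := by
      rintro rfl
      simpa using hB.1.1
    have hlt := val_add_ip_lt hP hB.2 hPB
    rw [ip_sub_right] at hlt
    refine ⟨(E.val B - ip (E.grad P) B) - (E.val P - ip (E.grad P) P), by linarith, ?_⟩
    intro A hA hr
    have hr0 : 0 < ‖A - P‖ := zero_lt_one.trans_le hr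
    have h1 := hmin _ (hretract A hA hr)
    have h2 := val_combination_le (E := E) hP.mem_dom hA
      (sub_nonneg.2 (inv_le_one_of_one_le₀ hr)) (inv_nonneg.2 hr0.le) (sub_add_cancel _ _)
    rw [ip_add_right, ip_smul_right, ip_smul_right] at h1
    have h3 : (E.val B - ip (E.grad P) B) - (E.val P - ip (E.grad P) P) ≤
        ‖A - P‖⁻¹ * ((E.val A - ip (E.grad P) A) - (E.val P - ip (E.grad P) P)) := by
      linarith
    rw [le_inv_mul_iff₀ hr0] at h3
    linarith
  · exact ⟨1, one_pos, fun A hA hr => (hne ⟨_, hretract A hA hr⟩).elim⟩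

theorem exists_forall_val_sub_ip_grad_le {P : Mat m} (hP : P.PosDef) {C : Set (Mat m)}
    (hC : IsClosed C) (hherm : ∀ A ∈ C, A.IsHermitian) (hne : (C ∩ E.dom).Nonempty) :
    ∃ A ∈ C ∩ E.dom, ∀ B ∈ C ∩ E.dom,
      E.val A - ip (E.grad P) A ≤ E.val B - ip (E.grad P) B := by
  have : ProperSpace (Mat m) := FiniteDimensional.proper_real _
  obtain ⟨δ, hδ, hgrow⟩ := exists_linear_growth (E := E) hP
  obtain ⟨Q, hQ⟩ := hne
  set R : ℝ :=
    max 1 (((E.val Q - ip (E.grad P) Q) - (E.val P - ip (E.grad P) P)) / δ) with hR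
  have hQR : ‖Q - P‖ ≤ R := by
    rcases le_total ‖Q - P‖ 1 with h | h
    · exact h.trans (le_max_left _ _)
    · refine le_trans ?_ (le_max_right _ _)
      rw [le_div_iff₀ hδ]
      linarith [hgrow Q hQ.2 h]
  have hQK : Q ∈ (C ∩ Metric.closedBall P R) ∩ E.dom :=
    ⟨⟨hQ.1, mem_closedBall_iff_norm.2 hQR⟩, hQ.2⟩
  obtain ⟨A, hA, hmin⟩ := exists_forall_val_sub_ip_le_of_isCompact
    ((isCompact_closedBall P R).inter_left hC) (fun A hA => hherm A hA.1) ⟨Q, hQK⟩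
    (E.grad P)
  refine ⟨A, ⟨hA.1.1, hA.2⟩, fun B hB => ?_⟩
  rcases le_or_gt ‖B - P‖ R with h | h
  · exact hmin B ⟨⟨hB.1, mem_closedBall_iff_norm.2 h⟩, hB.2⟩
  · have h1 := hgrow B hB.2 ((le_max_left _ _).trans h.le)
    have h2 := (le_max_right _ _).trans h.le
    rw [div_le_iff₀ hδ] at h2
    linarith [hmin Q hQK]

end Growth

/-- A minimizer of `F - ⟨L, ·⟩` along the segment to a positive definite matrix is itself
positive definite, when `F` is essentially smooth. -/
theorem posDef_of_forall_segment_le (hess : EssSmooth E) {A Q L : Mat m} (hA : A ∈ E.dom)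
    (hQ : Q.PosDef)
    (hmin : ∀ t : ℝ, 0 < t → t ≤ 1 →
      E.val A - ip L A ≤ E.val (A + t • (Q - A)) - ip L (A + t • (Q - A))) :
    A.PosDef := by
  by_contra hnot
  have hpsd := E.dom_subset_psd A hA.2
  set t : ℕ → ℝ := fun k => 1 / ((k : ℝ) + 1) with ht
  have ht0 : ∀ k, 0 < t k := fun k => Nat.one_div_pos_of_nat
  have ht1 : ∀ k, t k ≤ 1 := fun k => by
    rw [ht, div_le_one (by positivity)]
    linarith [Nat.cast_nonneg (α := ℝ) k]
  set P : ℕ → Mat m := fun k => A + t k • (Q - A) with hPdef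
  have hP : ∀ k, (P k).PosDef := fun k => by
    have he : P k = t k • Q + (1 - t k) • A := by simp only [hPdef]; module
    rw [he]
    exact posDef_combination hQ hpsd (ht0 k) (sub_nonneg.2 (ht1 k))
  have hlim : Tendsto P atTop (𝓝 A) := by
    have h := (tendsto_one_div_add_atTop_nhds_zero_nat (𝕜 := ℝ)).smul_const (Q - A)
    simpa [hPdef, ht] using h.const_add A
  have hdir : ∀ k, ip L (Q - A) ≤ ip (E.grad (P k)) (Q - A) := fun k => by
    have h1 := val_add_ip_le (hP k) hA
    have h2 := hmin (t k) (ht0 k) (ht1 k)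
    have he : A - P k = -(t k • (Q - A)) := by simp only [hPdef]; abel
    rw [he, ip_neg_right, ip_smul_right] at h1
    rw [ip_add_right, ip_smul_right] at h2
    change _ ≤ E.val (P k) - _ at h2
    refine le_of_mul_le_mul_left ?_ (ht0 k)
    linarith
  have hbound : ∀ H : Mat m, H.IsHermitian → ∃ C, ∀ k, ip (E.grad (P k)) H ≤ C := by
    intro H hH
    obtain ⟨ε, hε, hball⟩ := Metric.eventually_nhds_iff.1 (eventually_posDef_add_smul hQ hH)
    have hη : 0 < ε / 2 := by linarith
    have hR : (Q + (ε / 2) • H).PosDef := hball (by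
      rw [Real.dist_eq, sub_zero, abs_of_pos hη]; linarith)
    set R : Mat m := Q + (ε / 2) • H with hRdef
    refine ⟨(|ip (E.grad R) (R - A)| + |ip (E.grad R) (Q - A)| + |ip L (Q - A)|) / (ε / 2),
      fun k => ?_⟩
    rw [le_div_iff₀ hη]
    have h := ip_grad_sub_nonneg (E := E) hR (hP k)
    have he1 : R - P k = (R - A) - t k • (Q - A) := by simp only [hPdef]; abel
    have he2 : R - P k = (ε / 2) • H + (1 - t k) • (Q - A) := by
      simp only [hPdef, hRdef]; module
    rw [ip_sub_left] at h
    nth_rewrite 1 [he1] at h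
    rw [he2, ip_sub_right, ip_smul_right, ip_add_right, ip_smul_right, ip_smul_right] at h
    have hs : 0 ≤ 1 - t k := sub_nonneg.2 (ht1 k)
    have b1 := le_abs_self (ip (E.grad R) (R - A))
    have b2 : -(t k * ip (E.grad R) (Q - A)) ≤ |ip (E.grad R) (Q - A)| := by
      rw [← mul_neg]
      refine (mul_le_mul_of_nonneg_left (neg_le_abs _) (ht0 k).le).trans ?_
      exact mul_le_of_le_one_left (abs_nonneg _) (ht1 k)
    have b3 : -((1 - t k) * ip (E.grad (P k)) (Q - A)) ≤ |ip L (Q - A)| := by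
      rw [← mul_neg]
      have : -ip (E.grad (P k)) (Q - A) ≤ |ip L (Q - A)| :=
        (neg_le_neg (hdir k)).trans (neg_le_abs _)
      refine (mul_le_mul_of_nonneg_left this hs).trans ?_
      exact mul_le_of_le_one_left (abs_nonneg _) (by linarith [ht0 k])
    linarith
  choose C hC using hbound
  have hentry : ∀ k i j, |E.grad (P k) i j| ≤
      ∑ a, ∑ b, (|C _ (isHermitian_symmUnit a b)| + |C _ (isHermitian_symmUnit a b).neg|) := by
    intro k i j
    refine le_trans ?_ (Finset.single_le_sum (f := fun a => ∑ b,
      (|C _ (isHermitian_symmUnit a b)| + |C _ (isHermitian_symmUnit a b).neg|))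
      (fun a _ => Finset.sum_nonneg fun b _ => by positivity) (Finset.mem_univ i))
    refine le_trans ?_ (Finset.single_le_sum (f := fun b =>
      (|C _ (isHermitian_symmUnit i b)| + |C _ (isHermitian_symmUnit i b).neg|))
      (fun b _ => by positivity) (Finset.mem_univ j))
    have h1 := hC _ (isHermitian_symmUnit i j) k
    have h2 := hC _ (isHermitian_symmUnit i j).neg k
    rw [ip_neg_right] at h2
    rw [ip_symmUnit (E.grad_isHermitian _ (hP k))] at h1 h2
    have c1 := le_abs_self (C _ (isHermitian_symmUnit i j))
    have c2 := le_abs_self (C _ (isHermitian_symmUnit i j).neg)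
    have c3 := abs_nonneg (C _ (isHermitian_symmUnit i j))
    have c4 := abs_nonneg (C _ (isHermitian_symmUnit i j).neg)
    exact abs_le.2 ⟨by linarith, by linarith⟩
  have htop := hess P A hP hlim hpsd hnot
  obtain ⟨k, hk⟩ := (htop.eventually_gt_atTop _).exists
  exact absurd (fnorm_le_of_forall_abs_le (hentry k)) (not_le.2 hk)

end EClass

section Components

variable {s : Set (Fin m × Fin m)}

theorem comp_eq_comp_iff {P Q : Mat m} :
    comp s P = comp s Q ↔ ∀ i j, (i, j) ∈ s → P i j = Q i j := by
  constructor
  · intro h i j hij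
    simpa [comp, hij] using congrFun (congrFun h i) j
  · intro h
    ext i j
    by_cases hij : (i, j) ∈ s
    · simpa [comp, hij] using h i j hij
    · simp [comp, hij]

theorem ip_eq_zero_of_disjoint_support (hs : ∀ i j : Fin m, (i, j) ∈ s ↔ (j, i) ∈ s)
    {A B : Mat m} (hA : ∀ i j, (i, j) ∉ s → A i j = 0) (hB : ∀ i j, (i, j) ∈ s → B i j = 0) :
    ip A B = 0 := by
  rw [ip_eq_sum]
  refine Finset.sum_eq_zero fun i _ => Finset.sum_eq_zero fun j _ => ?_
  by_cases h : (i, j) ∈ s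
  · rw [hB j i ((hs i j).1 h), mul_zero]
  · rw [hA i j h, zero_mul]

theorem symmUnit_apply_eq_zero (hs : ∀ i j : Fin m, (i, j) ∈ s ↔ (j, i) ∈ s) {i j : Fin m}
    (hij : (i, j) ∉ s) : ∀ a b, (a, b) ∈ s → symmUnit i j a b = 0 := by
  intro a b hab
  have h1 : ¬(i = a ∧ j = b) := by
    rintro ⟨rfl, rfl⟩
    exact hij hab
  have h2 : ¬(j = a ∧ i = b) := by
    rintro ⟨rfl, rfl⟩
    exact hij ((hs _ _).1 hab)
  simp [symmUnit, Matrix.single, h1, h2]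

end Components

/-- mixed parametrization, Theorem `th:mixed`. Let `F ∈ 𝓔^m` be
essentially smooth and fix a symmetric set `s` of entry positions (the `A`-entries, whose
complement gives the `B`-entries). Then `Σ ↦ (Σ_A, (∇F(Σ))_B)` is a bijection from
`S^m_+` onto `(S^m_+)_A × (𝕃^m_+)_B`. -/
theorem mixed_parametrization {m : ℕ} (E : EClass m) (hess : EssSmooth E)
    (s : Set (Fin m × Fin m)) (hs : ∀ i j : Fin m, (i, j) ∈ s ↔ (j, i) ∈ s) :
    Set.BijOn (fun P : Mat m => (comp s P, comp sᶜ (E.grad P)))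
      {A : Mat m | A.PosDef}
      ((comp s '' {A : Mat m | A.PosDef}) ×ˢ (comp sᶜ '' Lplus E)) := by
  refine ⟨fun P hP => ⟨⟨P, hP, rfl⟩, ⟨E.grad P, ⟨P, hP, rfl⟩, rfl⟩⟩, ?_, ?_⟩
  · intro P hP Q hQ hPQ
    obtain ⟨h1, h2⟩ := Prod.mk.inj hPQ
    rw [comp_eq_comp_iff] at h1 h2
    by_contra hne
    refine (EClass.ip_grad_sub_pos (E := E) hP hQ hne).ne' ?_
    exact ip_eq_zero_of_disjoint_support hs (fun i j h => sub_eq_zero.2 (h2 i j h))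
      fun i j h => sub_eq_zero.2 (h1 i j h)
  · rintro ⟨_, _⟩ ⟨⟨Q, hQ, rfl⟩, ⟨_, ⟨P, hP, rfl⟩, rfl⟩⟩
    rw [Set.mem_ofPred_eq] at hQ hP
    set C : Set (Mat m) := {A | A.IsHermitian} ∩ {A | ∀ i j, (i, j) ∈ s → A i j = Q i j}
      with hCdef
    have hC : IsClosed C := by
      refine EClass.isClosed_setOf_isHermitian.inter ?_
      simp only [Set.ofPred_forall]
      exact isClosed_iInter fun i => isClosed_iInter fun j => isClosed_iInter fun _ =>
        isClosed_eq (by fun_prop) continuous_const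
    obtain ⟨A, ⟨hAC, hA⟩, hmin⟩ := EClass.exists_forall_val_sub_ip_grad_le (E := E) hP hC
      (fun A hA => hA.1) ⟨Q, ⟨hQ.isHermitian, fun _ _ _ => rfl⟩, hQ.mem_dom⟩
    have hApd : A.PosDef := by
      refine EClass.posDef_of_forall_segment_le hess hA hQ (L := E.grad P) fun t ht0 ht1 => ?_
      have he : A + t • (Q - A) = (1 - t) • A + t • Q := by module
      have hmem := EClass.combination_mem_dom hA (hQ.mem_dom (E := E)) (sub_nonneg.2 ht1)
        ht0.le (sub_add_cancel 1 t)
      rw [← he] at hmem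
      refine hmin _ ⟨⟨hmem.1, fun i j hij => ?_⟩, hmem⟩
      simp [hAC.2 i j hij]
    refine ⟨A, hApd, Prod.ext (comp_eq_comp_iff.2 hAC.2) (comp_eq_comp_iff.2 fun i j hij => ?_)⟩
    have hH := isHermitian_symmUnit i j
    have hderiv : HasDerivAt (fun t : ℝ => E.val (A + t • symmUnit i j) -
        ip (E.grad P) (A + t • symmUnit i j))
        (ip (E.grad A) (symmUnit i j) - ip (E.grad P) (symmUnit i j)) 0 := by
      refine (E.hasGradAt A hApd _ hH).sub ?_
      simp only [ip_add_right, ip_smul_right]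
      simpa using ((hasDerivAt_id (0 : ℝ)).mul_const
        (ip (E.grad P) (symmUnit i j))).const_add (ip (E.grad P) A)
    have hloc : IsLocalMin (fun t : ℝ => E.val (A + t • symmUnit i j) -
        ip (E.grad P) (A + t • symmUnit i j)) 0 := by
      filter_upwards [eventually_posDef_add_smul hApd hH] with t ht
      simp only [zero_smul, add_zero]
      refine hmin _ ⟨⟨ht.isHermitian, fun a b hab => ?_⟩, ht.mem_dom⟩
      simp [symmUnit_apply_eq_zero hs hij a b hab, hAC.2 a b hab]
    have h0 := hloc.hasDerivAt_eq_zero hderiv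
    rw [ip_symmUnit (E.grad_isHermitian A hApd), ip_symmUnit (E.grad_isHermitian P hP)] at h0
    linarith

end Entropic
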